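/- Let G be a finite group and ρ a nonzero finite-dimensional complex representation of G such that the McKay graph Γ(G,ρ) is a forest, i.e. for all μ,λ ∈ Irr(G) one has [μ⊗ρ:λ] = [λ⊗ρ:μ] ≤ 1 and [μ⊗ρ:μ] = 0, and the underlying simple graph on Irr(G) (with μ adjacent to λ iff [μ⊗ρ:λ] = 1) is acyclic. Then ρ is irreducible and self-dual (ρ ≅ ρ*). -/

import Mathlib

open scoped TensorProduct

/-- The dimension of the space of `G`-equivariant linear maps between two representations;
when `τ` is irreducible this is the multiplicity `[π : τ]`. -/
noncomputable def multHom {G V W : Type} [Group G]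
    [AddCommGroup V] [Module ℂ V] [AddCommGroup W] [Module ℂ W]
    (π : Representation ℂ G V) (τ : Representation ℂ G W) : ℕ :=
  Module.finrank ℂ (Representation.linHom π τ).invariants

/-- A representation is irreducible if it is nonzero and has no nontrivial invariant subspaces. -/
def IsIrreducibleRep {G V : Type} [Group G] [AddCommGroup V] [Module ℂ V]
    (ρ : Representation ℂ G V) : Prop :=
  Nontrivial V ∧ ∀ p : Submodule ℂ V, (∀ g : G, ∀ v ∈ p, ρ g v ∈ p) → p = ⊥ ∨ p = ⊤

/-- Two representations are isomorphic if there is an equivariant linear equivalence. -/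
def RepIso {G V W : Type} [Group G] [AddCommGroup V] [Module ℂ V] [AddCommGroup W] [Module ℂ W]
    (π : Representation ℂ G V) (τ : Representation ℂ G W) : Prop :=
  ∃ e : V ≃ₗ[ℂ] W, ∀ (g : G) (v : V), e (π g v) = τ g (e v)

theorem aux_leaf {ι : Type} [Finite ι] [Nonempty ι] (H : SimpleGraph ι) (hH : H.IsAcyclic) :
    ∃ v, ∀ x y, H.Adj v x → H.Adj v y → x = y := by
  classical
  have : Fintype ι := Fintype.ofFinite ι
  let S : Set ℕ := {n | ∃ (u v : ι) (p : H.Walk u v), p.IsPath ∧ p.length = n}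
  have hS : S.Nonempty := by
    obtain ⟨u⟩ := ‹Nonempty ι›
    exact ⟨0, u, u, .nil, by simp, by simp⟩
  have hb : BddAbove S := by
    refine ⟨Fintype.card ι, ?_⟩
    rintro n ⟨u, v, p, hp, rfl⟩
    exact hp.length_lt.le
  obtain ⟨u, v, p, hp, hl⟩ := Nat.sSup_mem hS hb
  have key : ∀ w, H.Adj v w → w = p.penultimate := by
    intro w hw
    by_cases hm : w ∈ p.support
    · exact hH.eq_penultimate_of_adj_end hp hw hm
    · have h1 : (p.concat hw).IsPath := hp.concat hm hw
      have h2 : p.length + 1 ≤ sSup S := le_csSup hb ⟨u, w, _, h1, by simp⟩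
      omega
  exact ⟨v, fun x y hx hy => (key x hx).trans (key y hy).symm⟩

theorem aux_mem {G V W : Type} [Group G]
    [AddCommGroup V] [Module ℂ V] [AddCommGroup W] [Module ℂ W]
    (π : Representation ℂ G V) (τ : Representation ℂ G W) (f : V →ₗ[ℂ] W) :
    f ∈ (Representation.linHom π τ).invariants ↔ ∀ g v, f (π g v) = τ g (f v) := by
  constructor
  · intro h g v
    have h1 := h g
    have h2 := LinearMap.congr_fun h1 (π g v)
    simp only [Representation.linHom_apply, LinearMap.comp_apply] at h2
    rw [← h2]; simp
  · intro h g
    ext v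
    simp [Representation.linHom_apply, ← h]

theorem aux_pos {G V W : Type} [Group G]
    [AddCommGroup V] [Module ℂ V] [AddCommGroup W] [Module ℂ W]
    [FiniteDimensional ℂ V] [FiniteDimensional ℂ W]
    (π : Representation ℂ G V) (τ : Representation ℂ G W) (f : V →ₗ[ℂ] W) (hf : f ≠ 0)
    (h : ∀ g v, f (π g v) = τ g (f v)) : multHom π τ ≠ 0 := by
  intro h0
  unfold multHom at h0
  have := Module.finrank_zero_iff.mp h0
  apply hf
  have h1 := Subsingleton.elim (⟨f, (aux_mem π τ f).2 h⟩ : (Representation.linHom π τ).invariants) 0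
  exact congrArg Subtype.val h1

theorem aux_exists {G V W : Type} [Group G]
    [AddCommGroup V] [Module ℂ V] [AddCommGroup W] [Module ℂ W]
    (π : Representation ℂ G V) (τ : Representation ℂ G W) (h : multHom π τ ≠ 0) :
    ∃ f : V →ₗ[ℂ] W, f ≠ 0 ∧ ∀ g v, f (π g v) = τ g (f v) := by
  have := Module.nontrivial_of_finrank_pos (Nat.pos_of_ne_zero h)
  obtain ⟨f, hf⟩ := exists_ne (0 : (Representation.linHom π τ).invariants)
  exact ⟨f.1, fun h0 => hf (Subtype.ext h0), (aux_mem π τ f.1).1 f.2⟩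

theorem aux_prop {G V W : Type} [Group G]
    [AddCommGroup V] [Module ℂ V] [AddCommGroup W] [Module ℂ W]
    [FiniteDimensional ℂ V] [FiniteDimensional ℂ W]
    (π : Representation ℂ G V) (τ : Representation ℂ G W) (h : multHom π τ ≤ 1)
    (f₁ f₂ : V →ₗ[ℂ] W) (hf : f₁ ≠ 0)
    (h₁ : ∀ g v, f₁ (π g v) = τ g (f₁ v)) (h₂ : ∀ g v, f₂ (π g v) = τ g (f₂ v)) :
    ∃ c : ℂ, f₂ = c • f₁ := by
  have hle : multHom π τ = 1 := by have := aux_pos π τ f₁ hf h₁; omega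
  have hn : (⟨f₁, (aux_mem π τ f₁).2 h₁⟩ : (Representation.linHom π τ).invariants) ≠ 0 :=
    fun h0 => hf (congrArg Subtype.val h0)
  obtain ⟨c, hc⟩ := (finrank_eq_one_iff_of_nonzero' _ hn).1 hle ⟨f₂, (aux_mem π τ f₂).2 h₂⟩
  exact ⟨c, (congrArg Subtype.val hc).symm⟩

theorem aux_quot {G : Type} [Group G] (n : ℕ) : ∀ {V : Type} [AddCommGroup V] [Module ℂ V]
    [FiniteDimensional ℂ V] (π : Representation ℂ G V), Nontrivial V → Module.finrank ℂ V = n →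
    ∃ (U : Type) (_ : AddCommGroup U) (_ : Module ℂ U) (_ : FiniteDimensional ℂ U)
      (σ : Representation ℂ G U) (f : V →ₗ[ℂ] U), IsIrreducibleRep σ ∧ f ≠ 0 ∧
        ∀ g v, f (π g v) = σ g (f v) := by
  induction n using Nat.strong_induction_on with
  | _ n ih =>
    intro V _ _ _ π hV hn
    by_cases hirr : IsIrreducibleRep π
    · refine ⟨V, inferInstance, inferInstance, inferInstance, π, LinearMap.id, hirr, ?_, ?_⟩
      · intro h0
        obtain ⟨v, hv⟩ := exists_ne (0 : V)
        exact hv (LinearMap.congr_fun h0 v)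
      · simp
    · unfold IsIrreducibleRep at hirr
      push Not at hirr
      obtain ⟨p, hp, hbot, htop⟩ := hirr hV
      have hnt : Nontrivial (V ⧸ p) := Submodule.Quotient.nontrivial_iff.2 htop
      have hlt : Module.finrank ℂ (V ⧸ p) < n := by
        have h1 := Submodule.finrank_quotient_add_finrank p
        have h2 : Module.finrank ℂ p ≠ 0 := fun h0 => hbot (Submodule.finrank_eq_zero.1 h0)
        omega
      obtain ⟨U, i1, i2, i3, σ, f, h1, h2, h3⟩ := ih _ hlt (π.quotient p hp) hnt rfl
      refine ⟨U, i1, i2, i3, σ, f ∘ₗ p.mkQ, h1, ?_, ?_⟩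
      · intro h0
        apply h2
        ext v
        exact LinearMap.congr_fun h0 v
      · intro g v
        exact h3 g (p.mkQ v)

theorem aux_compl {G V : Type} [Group G] [Finite G] [AddCommGroup V] [Module ℂ V]
    (ρ : Representation ℂ G V) (p : Submodule ℂ V) (hp : ∀ g : G, ∀ v ∈ p, ρ g v ∈ p) :
    ∃ q : Submodule ℂ V, (∀ g : G, ∀ v ∈ q, ρ g v ∈ q) ∧ IsCompl p q := by
  have : NeZero (Nat.card G : ℂ) := ⟨by exact_mod_cast Nat.card_pos.ne'⟩
  have hs : Representation.IsSemisimpleRepresentation ρ := inferInstance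
  obtain ⟨q, hq⟩ := hs.exists_isCompl ⟨p, hp⟩
  refine ⟨q.toSubmodule, q.apply_mem_toSubmodule, ?_⟩
  constructor
  · rw [disjoint_iff]
    exact congrArg Subrepresentation.toSubmodule (disjoint_iff.1 hq.1)
  · rw [codisjoint_iff]
    exact congrArg Subrepresentation.toSubmodule (codisjoint_iff.1 hq.2)

/-- Nonzero map from the tensor product through a retract. -/
theorem aux_retract {G : Type} [Group G]
    {V A X : Type} [AddCommGroup V] [Module ℂ V] [FiniteDimensional ℂ V]
    [AddCommGroup A] [Module ℂ A] [FiniteDimensional ℂ A] [Nontrivial A]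
    [AddCommGroup X] [Module ℂ X] [FiniteDimensional ℂ X] [Nontrivial X]
    (ρ : Representation ℂ G V) (α : Representation ℂ G A) (ξ : Representation ℂ G X)
    (s : A →ₗ[ℂ] V) (r : V →ₗ[ℂ] A) (hrs : ∀ a, r (s a) = a)
    (hr : ∀ g v, r (ρ g v) = α g (r v))
    {ι : Type}
    (W : ι → Type) [∀ i, AddCommGroup (W i)] [∀ i, Module ℂ (W i)]
    (Irr : (i : ι) → Representation ℂ G (W i))
    (hcompl : ∀ (U : Type) [AddCommGroup U] [Module ℂ U] [FiniteDimensional ℂ U]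
      (σ : Representation ℂ G U), IsIrreducibleRep σ → ∃ i, RepIso σ (Irr i)) :
    ∃ (j : ι) (f : X ⊗[ℂ] V →ₗ[ℂ] W j), (∀ g v, f (ξ.tprod ρ g v) = Irr j g (f v)) ∧
      (∀ x v, r v = 0 → f (x ⊗ₜ v) = 0) ∧ (∃ x a, f (x ⊗ₜ s a) ≠ 0) := by
  have hnt : Nontrivial (X ⊗[ℂ] A) := inferInstance
  obtain ⟨U, i1, i2, i3, σ, f, h1, h2, h3⟩ := aux_quot _ (ξ.tprod α) hnt rfl
  obtain ⟨j, e, he⟩ := hcompl U σ h1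
  refine ⟨j, e.toLinearMap ∘ₗ f ∘ₗ LinearMap.lTensor X r, ?_, ?_, ?_⟩
  · intro g v
    have : LinearMap.lTensor X r (ξ.tprod ρ g v) = ξ.tprod α g (LinearMap.lTensor X r v) := by
      induction v with
      | zero => simp
      | add a b ha hb => simp only [map_add, ha, hb]
      | tmul x y => simp [Representation.tprod_apply, hr]
    simp only [LinearMap.comp_apply, LinearEquiv.coe_coe, this, h3, he]
  · intro x v hv
    simp [hv]
  · by_contra hcon
    push Not at hcon
    apply h2
    ext x a
    simpa [hrs] using hcon x a

/-- If the McKay graph `Γ(G,ρ)` of a nonzero representation `ρ` of a finite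
group `G` is a forest, then `ρ` is irreducible and self-dual. -/
theorem mckay_forest_irreducible_selfdual
    {G : Type} [Group G] [Fintype G]
    {V : Type} [AddCommGroup V] [Module ℂ V] [FiniteDimensional ℂ V]
    (ρ : Representation ℂ G V) (hV : Module.finrank ℂ V ≠ 0)
    {ι : Type} [Fintype ι]
    (W : ι → Type) [∀ i, AddCommGroup (W i)] [∀ i, Module ℂ (W i)]
    [∀ i, FiniteDimensional ℂ (W i)]
    (Irr : (i : ι) → Representation ℂ G (W i))
    (hirr : ∀ i, IsIrreducibleRep (Irr i))
    (hdist : ∀ i j, RepIso (Irr i) (Irr j) → i = j)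
    (hcompl : ∀ (U : Type) [AddCommGroup U] [Module ℂ U] [FiniteDimensional ℂ U]
      (σ : Representation ℂ G U), IsIrreducibleRep σ → ∃ i, RepIso σ (Irr i))
    (hsym : ∀ i j, multHom ((Irr i).tprod ρ) (Irr j) = multHom ((Irr j).tprod ρ) (Irr i))
    (hle : ∀ i j, multHom ((Irr i).tprod ρ) (Irr j) ≤ 1)
    (hloop : ∀ i, multHom ((Irr i).tprod ρ) (Irr i) = 0)
    (hforest :
      (SimpleGraph.fromRel fun i j => multHom ((Irr i).tprod ρ) (Irr j) = 1).IsAcyclic) :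
    IsIrreducibleRep ρ ∧ RepIso ρ ρ.dual := by
  have hVn : Nontrivial V := Module.nontrivial_of_finrank_pos (Nat.pos_of_ne_zero hV)
  have hWn : ∀ i, Nontrivial (W i) := fun i => (hirr i).1
  -- the trivial representation
  obtain ⟨t, et, het⟩ : ∃ t, RepIso (Representation.trivial ℂ G ℂ) (Irr t) := by
    apply hcompl
    exact ⟨inferInstance, fun p _ => eq_bot_or_eq_top p⟩
  have : Nonempty ι := ⟨t⟩
  -- irreducibility
  have hρ : IsIrreducibleRep ρ := by
    obtain ⟨i, hi⟩ := aux_leaf _ hforest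
    have hi' : ∀ x y, multHom ((Irr i).tprod ρ) (Irr x) ≠ 0 →
        multHom ((Irr i).tprod ρ) (Irr y) ≠ 0 → x = y := by
      have hadj : ∀ x, multHom ((Irr i).tprod ρ) (Irr x) ≠ 0 →
          (SimpleGraph.fromRel fun i j => multHom ((Irr i).tprod ρ) (Irr j) = 1).Adj i x := by
        intro x hx
        rw [SimpleGraph.fromRel_adj]
        refine ⟨?_, Or.inl ?_⟩
        · rintro rfl
          exact hx (hloop _)
        · have := hle i x
          omega
      exact fun x y hx hy => hi x y (hadj x hx) (hadj y hy)
    refine ⟨hVn, fun p hp => ?_⟩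
    by_contra hcon
    push Not at hcon
    obtain ⟨hbot, htop⟩ := hcon
    obtain ⟨q, hq, hpq⟩ := aux_compl ρ p hp
    have hqbot : q ≠ ⊥ := by
      rintro rfl
      exact htop (by simpa using hpq.2)
    have key : ∀ (p q : Submodule ℂ V) (hp : ∀ g : G, ∀ v ∈ p, ρ g v ∈ p)
        (hq : ∀ g : G, ∀ v ∈ q, ρ g v ∈ q) (hpq : IsCompl p q) (hb : p ≠ ⊥),
        ∃ (j : ι) (f : W i ⊗[ℂ] V →ₗ[ℂ] W j),
          (∀ g v, f ((Irr i).tprod ρ g v) = Irr j g (f v)) ∧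
          (∀ x, ∀ v ∈ q, f (x ⊗ₜ v) = 0) ∧ (∃ x, ∃ a ∈ p, f (x ⊗ₜ a) ≠ 0) := by
      intro p q hp hq hpq hb
      have : Nontrivial p := Submodule.nontrivial_iff_ne_bot.2 hb
      obtain ⟨j, f, h1, h2, x, a, h3⟩ := aux_retract ρ (ρ.subrepresentation p hp) (Irr i)
        p.subtype (p.projectionOnto q hpq) (fun a => by simp) (by
          intro g v
          obtain ⟨a, ha, b, hb, rfl⟩ : ∃ a ∈ p, ∃ b ∈ q, a + b = v :=
            Submodule.mem_sup.1 (by rw [hpq.sup_eq_top]; trivial)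
          have e1 := Submodule.projectionOnto_apply_left hpq ⟨a, ha⟩
          have e2 := Submodule.projectionOnto_apply_left hpq ⟨ρ g a, hp g a ha⟩
          have e3 := (Submodule.projectionOnto_apply_eq_zero_iff hpq).2 hb
          have e4 := (Submodule.projectionOnto_apply_eq_zero_iff hpq).2 (hq g b hb)
          simp only at e1 e2
          rw [map_add, map_add, map_add, e1, e2, e3, e4, add_zero, add_zero]
          rfl) W Irr hcompl
      exact ⟨j, f, h1, fun x v hv =>
        h2 x v ((Submodule.projectionOnto_apply_eq_zero_iff hpq).2 hv), x, a, a.2, h3⟩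
    obtain ⟨j, f, hf1, hf2, x, a, ha, hf3⟩ := key p q hp hq hpq hbot
    obtain ⟨j', f', hf1', hf2', x', a', ha', hf3'⟩ := key q p hq hp hpq.symm hqbot
    have hf0 : f ≠ 0 := by rintro rfl; simp at hf3
    have hf0' : f' ≠ 0 := by rintro rfl; simp at hf3'
    obtain rfl := hi' j j' (aux_pos _ _ f hf0 hf1) (aux_pos _ _ f' hf0' hf1')
    obtain ⟨c, rfl⟩ := aux_prop _ _ (hle i j) f f' hf0 hf1 hf1'
    apply hf3'
    simp [hf2 x' a' ha']
  refine ⟨hρ, ?_⟩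
  obtain ⟨j, e, he⟩ := hcompl V ρ hρ
  have h1 : multHom ((Irr t).tprod ρ) (Irr j) ≠ 0 := by
    refine aux_pos _ _ (e.toLinearMap ∘ₗ (TensorProduct.lid ℂ V).toLinearMap ∘ₗ
      LinearMap.rTensor V et.symm.toLinearMap) ?_ ?_
    · intro h0
      obtain ⟨v, hv⟩ := exists_ne (0 : V)
      have := LinearMap.congr_fun h0 (et 1 ⊗ₜ v)
      simp at this
      exact hv this
    · intro g v
      have het' : ∀ w, et.symm (Irr t g w) = et.symm w := by
        intro w
        apply et.injective
        rw [LinearEquiv.apply_symm_apply]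
        have := het g (et.symm w)
        simp at this
        simpa using this.symm
      induction v with
      | zero => simp
      | add a b ha hb => simp only [map_add, ha, hb]
      | tmul x y => simp [Representation.tprod_apply, het', he]
  rw [hsym] at h1
  obtain ⟨f, hf0, hf⟩ := aux_exists _ _ h1
  let φ : V →ₗ[ℂ] Module.Dual ℂ V :=
    (TensorProduct.curry (et.symm.toLinearMap ∘ₗ f)) ∘ₗ e.toLinearMap
  have hφ : ∀ v w, φ v w = et.symm (f (e v ⊗ₜ w)) := fun v w => rfl
  have hinv : ∀ g v w, φ (ρ g v) (ρ g w) = φ v w := by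
    intro g v w
    rw [hφ, hφ, he]
    have h2 := hf g (e v ⊗ₜ w)
    rw [Representation.tprod_apply, TensorProduct.map_tmul] at h2
    rw [h2]
    apply et.injective
    have := het g (et.symm (f (e v ⊗ₜ w)))
    simp at this
    simpa using this.symm
  have heq : ∀ g v, φ (ρ g v) = ρ.dual g (φ v) := by
    intro g v
    ext w
    have := hinv g v (ρ g⁻¹ w)
    simp at this
    simpa [Representation.dual_apply, Module.Dual.transpose_apply] using this
  have hinj : Function.Injective φ := by
    rw [← LinearMap.ker_eq_bot]
    rcases hρ.2 (LinearMap.ker φ) (fun g v hv => by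
      rw [LinearMap.mem_ker] at hv ⊢
      rw [heq, hv, map_zero]) with h | h
    · exact h
    · exfalso
      apply hf0
      have h0 : φ = 0 := LinearMap.ker_eq_top.1 h
      ext x w
      have := hφ (e.symm x) w
      rw [h0] at this
      simpa using this.symm
  exact ⟨LinearEquiv.ofInjectiveOfFinrankEq φ hinj Subspace.dual_finrank_eq.symm,
    fun g v => heq g v⟩
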